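/- Let p ∈ (1,∞), ε > 0 and a < b be reals. Let v : [a,b] → ℝ be continuous with 0 ≤ v ≤ 1, v(a) = v(b) = 1, and suppose there exists an integrable function v′ : [a,b] → ℝ with v(t) = v(a) + ∫_a^t v′(s) ds for every t ∈ [a,b], and a point s₀ ∈ (a,b) with v(s₀) = 0. Then ∫_a^b ((1−v(t))^p/ε + ε^{p−1}|v′(t)|^p) dt ≥ 2(p−1)^{(1−p)/p} (the integral being understood in [0,+∞]). -/

import Mathlib

open MeasureTheory Filter Topology

open Set in
/-- Postcomposing an absolutely continuous function with a Lipschitz function preserves absolute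
continuity. -/
theorem LipschitzOnWith.comp_absolutelyContinuousOnInterval {X Y : Type*} [PseudoMetricSpace X]
    [PseudoMetricSpace Y] {f : ℝ → X} {g : X → Y} {K : NNReal} {s : Set X} {a b : ℝ}
    (hg : LipschitzOnWith K g s) (hf : AbsolutelyContinuousOnInterval f a b)
    (hfs : MapsTo f (uIcc a b) s) : AbsolutelyContinuousOnInterval (g ∘ f) a b := by
  rw [absolutelyContinuousOnInterval_iff] at hf ⊢
  intro ε hε
  obtain ⟨δ, hδ, h⟩ := hf (ε / (K + 1)) (by positivity)
  refine ⟨δ, hδ, fun E hE hlen ↦ ?_⟩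
  calc ∑ i ∈ Finset.range E.1, dist (g (f (E.2 i).1)) (g (f (E.2 i).2))
      ≤ ∑ i ∈ Finset.range E.1, (K + 1) * dist (f (E.2 i).1) (f (E.2 i).2) := by
        refine Finset.sum_le_sum fun i hi ↦ ?_
        have hmem := hE.1 i hi
        refine (hg.dist_le_mul _ (hfs hmem.1) _ (hfs hmem.2)).trans ?_
        gcongr
        simp
    _ = (K + 1) * ∑ i ∈ Finset.range E.1, dist (f (E.2 i).1) (f (E.2 i).2) := by
        rw [Finset.mul_sum]
    _ < (K + 1) * (ε / (K + 1)) := by gcongr; exact h E hE hlen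
    _ = ε := by field_simp

open Set in
theorem AbsolutelyContinuousOnInterval.enorm_sub_le_lintegral_deriv {f : ℝ → ℝ} {a b : ℝ}
    (hab : a ≤ b) (hf : AbsolutelyContinuousOnInterval f a b) :
    ‖f b - f a‖ₑ ≤ ∫⁻ t in Ioc a b, ‖deriv f t‖ₑ := by
  rw [← hf.integral_deriv_eq_sub, intervalIntegral.integral_of_le hab]
  exact enorm_integral_le_lintegral_enorm _

theorem Real.lipschitzOnWith_rpow_const_Icc_zero_one {p : ℝ} (hp : 1 ≤ p) :
    LipschitzOnWith p.toNNReal (fun x : ℝ ↦ x ^ p) (Set.Icc 0 1) := by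
  refine (convex_Icc (0 : ℝ) 1).lipschitzOnWith_of_nnnorm_hasDerivWithin_le
    (fun x _ ↦ (Real.hasDerivAt_rpow_const (Or.inr hp)).hasDerivWithinAt) fun x hx ↦ ?_
  rw [← NNReal.coe_le_coe, coe_nnnorm, Real.coe_toNNReal p (by linarith), Real.norm_eq_abs,
    abs_of_nonneg (mul_nonneg (by linarith) (Real.rpow_nonneg hx.1 _))]
  exact mul_le_of_le_one_right (by linarith) (Real.rpow_le_one hx.1 hx.2 (by linarith))

/-- The sharp Young inequality for the Ambrosio–Tortorelli density. -/
theorem ambrosioTortorelli_young {p ε x y : ℝ} (hp : 1 < p) (hε : 0 < ε) (hx : 0 ≤ x)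
    (hy : 0 ≤ y) :
    (p - 1) ^ ((1 - p) / p) * (y * p * x ^ (p - 1)) ≤ x ^ p / ε + ε ^ (p - 1) * y ^ p := by
  have hp0 : 0 < p := by linarith
  have hp1 : 0 < p - 1 := by linarith
  have key := Real.geom_mean_le_arith_mean2_weighted (w₁ := (p - 1) / p) (w₂ := 1 / p)
    (p₁ := p / (p - 1) * (x ^ p / ε)) (p₂ := p * (ε ^ (p - 1) * y ^ p))
    (by positivity) (by positivity) (by positivity) (by positivity) (by field_simp; ring)
  have hx' : (x ^ p) ^ ((p - 1) / p) = x ^ (p - 1) := by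
    rw [← Real.rpow_mul hx]; congr 1; field_simp
  have hy' : (y ^ p) ^ (1 / p) = y := by
    rw [← Real.rpow_mul hy, mul_one_div_cancel hp0.ne', Real.rpow_one]
  have hε' : (ε ^ (p - 1)) ^ (1 / p) = ε ^ ((p - 1) / p) := by
    rw [← Real.rpow_mul hε.le, mul_one_div]
  have hpp : p ^ ((p - 1) / p) * p ^ (1 / p) = p := by
    rw [← Real.rpow_add hp0, ← add_div, sub_add_cancel, div_self hp0.ne', Real.rpow_one]
  have hneg : (p - 1) ^ ((1 - p) / p) = ((p - 1) ^ ((p - 1) / p))⁻¹ := by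
    rw [← Real.rpow_neg hp1.le]; congr 1; ring
  rw [Real.mul_rpow (by positivity) (by positivity), Real.div_rpow hp0.le hp1.le,
    Real.div_rpow (by positivity) hε.le, Real.mul_rpow hp0.le (by positivity),
    Real.mul_rpow (by positivity) (by positivity), hx', hy', hε'] at key
  have hεpos : 0 < ε ^ ((p - 1) / p) := by positivity
  have hp1pos : 0 < (p - 1) ^ ((p - 1) / p) := by positivity
  calc _ = ((p - 1) ^ ((p - 1) / p))⁻¹ * (y * (p ^ ((p - 1) / p) * p ^ (1 / p)) * x ^ (p - 1)) := by
        rw [hneg, hpp]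
    _ = _ := by field_simp
    _ ≤ _ := key
    _ = _ := by field_simp

open Set in
/-- The Ambrosio–Tortorelli energy on an interval bounds the variation of `(1 - u) ^ p` between the
endpoints. -/
theorem ambrosioTortorelli_transition_le {p ε : ℝ} (hp : 1 < p) (hε : 0 < ε) {c d : ℝ} (hcd : c ≤ d)
    {u u' : ℝ → ℝ} (hu : AbsolutelyContinuousOnInterval u c d)
    (h01 : ∀ t ∈ Icc c d, u t ∈ Icc (0 : ℝ) 1)
    (hderiv : ∀ᵐ t, t ∈ Ioc c d → HasDerivAt u (u' t) t) :
    ENNReal.ofReal ((p - 1) ^ ((1 - p) / p) * |(1 - u d) ^ p - (1 - u c) ^ p|) ≤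
      ∫⁻ t in Ioc c d, ENNReal.ofReal ((1 - u t) ^ p / ε + ε ^ (p - 1) * |u' t| ^ p) := by
  have hC : 0 ≤ (p - 1) ^ ((1 - p) / p) := Real.rpow_nonneg (by linarith) _
  have hac : AbsolutelyContinuousOnInterval (fun t ↦ (1 - u t) ^ p) c d := by
    refine (Real.lipschitzOnWith_rpow_const_Icc_zero_one hp.le).comp_absolutelyContinuousOnInterval
      (f := fun t ↦ 1 - u t) ?_ fun t ht ↦ ?_
    · have h1 : LipschitzOnWith 1 (fun x : ℝ ↦ 1 - x) univ :=
        (LipschitzWith.of_dist_le_mul fun x y ↦ by simpa only [NNReal.coe_one, one_mul] using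
          (dist_sub_left 1 x y).le).lipschitzOnWith
      exact h1.comp_absolutelyContinuousOnInterval hu (mapsTo_univ _ _)
    · rw [uIcc_of_le hcd] at ht
      have := h01 t ht
      exact ⟨by linarith [this.2], by linarith [this.1]⟩
  calc ENNReal.ofReal ((p - 1) ^ ((1 - p) / p) * |(1 - u d) ^ p - (1 - u c) ^ p|)
      = ENNReal.ofReal ((p - 1) ^ ((1 - p) / p)) * ‖(1 - u d) ^ p - (1 - u c) ^ p‖ₑ := by
        rw [ENNReal.ofReal_mul hC, Real.enorm_eq_ofReal_abs]
    _ ≤ ENNReal.ofReal ((p - 1) ^ ((1 - p) / p)) *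
          ∫⁻ t in Ioc c d, ‖deriv (fun t ↦ (1 - u t) ^ p) t‖ₑ := by
        gcongr
        exact hac.enorm_sub_le_lintegral_deriv hcd
    _ = ∫⁻ t in Ioc c d, ENNReal.ofReal ((p - 1) ^ ((1 - p) / p)) *
          ‖deriv (fun t ↦ (1 - u t) ^ p) t‖ₑ := (lintegral_const_mul' _ _ ENNReal.ofReal_ne_top).symm
    _ ≤ _ := by
        refine lintegral_mono_ae ((ae_restrict_iff' measurableSet_Ioc).2 ?_)
        filter_upwards [hderiv] with t ht htm
        have hx : 0 ≤ 1 - u t := by linarith [(h01 t (Ioc_subset_Icc_self htm)).2]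
        rw [(((ht htm).const_sub 1).rpow_const (p := p) (Or.inr hp.le)).deriv,
          Real.enorm_eq_ofReal_abs, ← ENNReal.ofReal_mul hC, abs_mul, abs_mul, abs_neg,
          abs_of_pos (by linarith : 0 < p), abs_of_nonneg (Real.rpow_nonneg hx _)]
        exact ENNReal.ofReal_le_ofReal (ambrosioTortorelli_young hp hε hx (abs_nonneg _))

/-- The one-dimensional lower bound underlying the Ambrosio–Tortorelli surface energy:
if `v` is a Sobolev function on `[a,b]` with values in `[0,1]`, equal to `1` at the
endpoints and vanishing at some interior point, then its scaled Modica–Mortola energy is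
at least `c_p = 2(p−1)^{(1−p)/p}` (the integral being understood in `[0,+∞]`). -/
theorem stmt9
    (p : ℝ) (hp : 1 < p) (ε : ℝ) (hε : 0 < ε)
    (a b : ℝ) (hab : a < b)
    (v v' : ℝ → ℝ)
    (hcont : ContinuousOn v (Set.Icc a b))
    (h01 : ∀ t ∈ Set.Icc a b, 0 ≤ v t ∧ v t ≤ 1)
    (hva : v a = 1) (hvb : v b = 1)
    (hint : IntegrableOn v' (Set.Icc a b))
    (hftc : ∀ t ∈ Set.Icc a b, v t = v a + ∫ s in a..t, v' s)
    (s₀ : ℝ) (hs₀ : s₀ ∈ Set.Ioo a b) (hvs₀ : v s₀ = 0) :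
    ENNReal.ofReal (2 * (p - 1) ^ ((1 - p) / p)) ≤
      ∫⁻ t in Set.Icc a b,
        ENNReal.ofReal ((1 - v t) ^ p / ε + ε ^ (p - 1) * |v' t| ^ p) := by
  set u : ℝ → ℝ := fun t ↦ v a + ∫ s in a..t, v' s with hu
  have hii : IntervalIntegrable v' volume a b :=
    (intervalIntegrable_iff_integrableOn_Icc_of_le hab.le).2 hint
  have hac : AbsolutelyContinuousOnInterval u a b := by
    have h1 : LipschitzOnWith 1 (fun x : ℝ ↦ v a + x) Set.univ :=
      (LipschitzWith.of_dist_le_mul fun x y ↦ by simp).lipschitzOnWith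
    exact h1.comp_absolutelyContinuousOnInterval
      (hii.absolutelyContinuousOnInterval_intervalIntegral (by simp)) (Set.mapsTo_univ _ _)
  have hderiv : ∀ᵐ t, t ∈ Set.Icc a b → HasDerivAt u (v' t) t := by
    filter_upwards [hii.ae_hasDerivAt_integral] with t ht htm
    rw [Set.uIcc_of_le hab.le] at ht
    exact (ht htm a (by simp [hab.le])).const_add _
  have htrans : ∀ c d, a ≤ c → c ≤ d → d ≤ b →
      ENNReal.ofReal ((p - 1) ^ ((1 - p) / p) * |(1 - v d) ^ p - (1 - v c) ^ p|) ≤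
        ∫⁻ t in Set.Ioc c d, ENNReal.ofReal ((1 - v t) ^ p / ε + ε ^ (p - 1) * |v' t| ^ p) := by
    intro c d hac' hcd hdb
    have hsub : Set.Icc c d ⊆ Set.Icc a b := Set.Icc_subset_Icc hac' hdb
    have h := ambrosioTortorelli_transition_le hp hε hcd (u := u) (u' := v')
      (hac.mono (by rwa [Set.uIcc_of_le hcd, Set.uIcc_of_le hab.le]))
      (fun t ht ↦ by
        have := h01 t (hsub ht)
        rwa [hftc t (hsub ht)] at this)
      (hderiv.mono fun t ht htm ↦ ht (hsub (Set.Ioc_subset_Icc_self htm)))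
    rw [hftc d (hsub ⟨hcd, le_rfl⟩), hftc c (hsub ⟨le_rfl, hcd⟩)]
    refine h.trans_eq (setLIntegral_congr_fun measurableSet_Ioc fun t ht ↦ ?_)
    simp only [hftc t (hsub (Set.Ioc_subset_Icc_self ht)), hu]
  have hleft := htrans a s₀ le_rfl hs₀.1.le hs₀.2.le
  have hright := htrans s₀ b hs₀.1.le hs₀.2.le le_rfl
  have hp0 : p ≠ 0 := by linarith
  simp only [hva, hvb, hvs₀, sub_self, sub_zero, Real.zero_rpow hp0, Real.one_rpow, zero_sub,
    abs_neg, abs_one, mul_one] at hleft hright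
  have hC : 0 ≤ (p - 1) ^ ((1 - p) / p) := Real.rpow_nonneg (by linarith) _
  rw [two_mul, ENNReal.ofReal_add hC hC, ← restrict_Ioc_eq_restrict_Icc,
    ← Set.Ioc_union_Ioc_eq_Ioc hs₀.1.le hs₀.2.le,
    lintegral_union measurableSet_Ioc (Set.Ioc_disjoint_Ioc_of_le le_rfl)]
  exact add_le_add hleft hright
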